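/- arXiv:1303.0091 — 3 statements merged into one kernel-verified Lean document; each statement's English description precedes it below -/
import Mathlib

section
/- The subgroup of Equiv.Perm (Fin 3 × ZMod 2) consisting of all permutations of the form (x, y) ↦ (σ x, y + f x) with σ ∈ Equiv.Perm (Fin 3) and f : Fin 3 → ZMod 2 (that is, the full cascade product of the symmetric group S₃ in its natural action on 3 points with a mod-2 counter) is isomorphic as a group to Multiplicative (ZMod 2) × Equiv.Perm (Fin 4); in particular it has order 48. -/
/-- The class in `Fin 3 × ZMod 2` of the two-element subset `{a, b}` of `Fin 4`: `{3, x}` is sent to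
`(x, 0)` and its complement to `(x, 1)`. -/
def edgeCode (a b : Fin 4) : Fin 3 × ZMod 2 :=
  if a = 3 then (Fin.ofNat 3 b.val, 0)
  else if b = 3 then (Fin.ofNat 3 a.val, 0)
  else (Fin.ofNat 3 (3 - a.val - b.val), 1)

/-- First endpoint of the edge with a given code. -/
def edgeFst (p : Fin 3 × ZMod 2) : Fin 4 :=
  if p.2 = 0 then 3 else if p.1 = 0 then 1 else 0

/-- Second endpoint of the edge with a given code. -/
def edgeSnd (p : Fin 3 × ZMod 2) : Fin 4 :=
  if p.2 = 0 then p.1.castSucc else if p.1 = 2 then 1 else 2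

/-- The action of `S₄` on edges. -/
def edgeAct (τ : Equiv.Perm (Fin 4)) (p : Fin 3 × ZMod 2) : Fin 3 × ZMod 2 :=
  edgeCode (τ (edgeFst p)) (τ (edgeSnd p))

theorem edgeCode_ends : ∀ p, edgeCode (edgeFst p) (edgeSnd p) = p := by decide

theorem edge_ends_ne : ∀ p, edgeFst p ≠ edgeSnd p := by decide

set_option maxRecDepth 100000 in
set_option maxHeartbeats 4000000 in
theorem edge_ends_code : ∀ a b : Fin 4, a ≠ b →
    ∀ c d : Fin 4, c ≠ d → edgeCode a b = edgeCode c d → (a = c ∧ b = d) ∨ (a = d ∧ b = c) := by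
  decide

theorem edgeCode_symm : ∀ a b : Fin 4, edgeCode a b = edgeCode b a := by
  decide

theorem edgeAct_code (σ : Equiv.Perm (Fin 4)) (a b : Fin 4) (h : a ≠ b) :
    edgeAct σ (edgeCode a b) = edgeCode (σ a) (σ b) := by
  unfold edgeAct
  rcases edge_ends_code _ _ (edge_ends_ne (edgeCode a b)) a b h (edgeCode_ends _) with
    ⟨h1, h2⟩ | ⟨h1, h2⟩
  · rw [h1, h2]
  · rw [h1, h2, edgeCode_symm]

theorem edgeAct_mul (σ τ : Equiv.Perm (Fin 4)) (p : Fin 3 × ZMod 2) :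
    edgeAct (σ * τ) p = edgeAct σ (edgeAct τ p) := by
  conv_rhs => rw [edgeAct.eq_1 τ]
  rw [edgeAct_code _ _ _ (τ.injective.ne (edge_ends_ne p))]
  rfl

set_option maxRecDepth 100000 in
set_option maxHeartbeats 4000000 in
theorem edgeAct_flip : ∀ (τ : Equiv.Perm (Fin 4)) (x : Fin 3) (y c : ZMod 2),
    edgeAct τ (x, y + c) = ((edgeAct τ (x, y)).1, (edgeAct τ (x, y)).2 + c) := by
  decide

set_option maxRecDepth 100000 in
set_option maxHeartbeats 4000000 in
theorem edgeAct_faithful : ∀ (c : ZMod 2) (τ : Equiv.Perm (Fin 4)),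
    (∀ x : Fin 3, ((edgeAct τ (x, 0)).1, (edgeAct τ (x, 0)).2 + c) = (x, (0 : ZMod 2))) →
      c = 0 ∧ τ = 1 := by
  decide

/-- The action of `C₂ × S₄` on edges, with `C₂` acting by complement. -/
def cascadeHom : Multiplicative (ZMod 2) × Equiv.Perm (Fin 4) →* Equiv.Perm (Fin 3 × ZMod 2) :=
  MonoidHom.toHomPerm
    { toFun := fun g p => ((edgeAct g.2 p).1, (edgeAct g.2 p).2 + g.1.toAdd)
      map_one' := by
        funext p
        have h : edgeAct 1 p = p := edgeCode_ends p
        change ((edgeAct 1 p).1, (edgeAct 1 p).2 + 0) = p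
        rw [h, add_zero]
      map_mul' := by
        intro g h
        funext p
        change ((edgeAct (g.2 * h.2) p).1, (edgeAct (g.2 * h.2) p).2 + (g.1.toAdd + h.1.toAdd)) =
          ((edgeAct g.2 ((edgeAct h.2 p).1, (edgeAct h.2 p).2 + h.1.toAdd)).1,
            (edgeAct g.2 ((edgeAct h.2 p).1, (edgeAct h.2 p).2 + h.1.toAdd)).2 + g.1.toAdd)
        rw [edgeAct_flip, edgeAct_mul]
        ext
        · rfl
        · simp only [Prod.mk.eta]
          ring }

theorem cascadeHom_apply (g : Multiplicative (ZMod 2) × Equiv.Perm (Fin 4))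
    (p : Fin 3 × ZMod 2) :
    cascadeHom g p = ((edgeAct g.2 p).1, (edgeAct g.2 p).2 + g.1.toAdd) := rfl

theorem cascadeHom_injective : Function.Injective cascadeHom := by
  rw [injective_iff_map_eq_one]
  rintro ⟨c, τ⟩ h
  have := edgeAct_faithful c.toAdd τ (fun x => by
    rw [← cascadeHom_apply (c, τ), h]; rfl)
  exact Prod.ext this.1 this.2

theorem cascadeHom_form (g : Multiplicative (ZMod 2) × Equiv.Perm (Fin 4)) :
    ∃ (σ : Equiv.Perm (Fin 3)) (f : Fin 3 → ZMod 2),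
      ∀ (x : Fin 3) (y : ZMod 2), cascadeHom g (x, y) = (σ x, y + f x) := by
  have key : ∀ (x : Fin 3) (y : ZMod 2), cascadeHom g (x, y) =
      ((cascadeHom g (x, 0)).1, y + (cascadeHom g (x, 0)).2) := by
    intro x y
    have := edgeAct_flip g.2 x 0 y
    rw [zero_add] at this
    simp only [cascadeHom_apply, this]
    ext
    · rfl
    · simp only
      ring
  have inj : Function.Injective (fun x : Fin 3 => (cascadeHom g (x, 0)).1) := by
    intro x x' h
    have h2 : cascadeHom g (x, (cascadeHom g (x', 0)).2 - (cascadeHom g (x, 0)).2) =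
        cascadeHom g (x', 0) := by
      rw [key]
      exact Prod.ext h (by simp)
    exact congrArg Prod.fst ((cascadeHom g).injective h2)
  exact ⟨Equiv.ofBijective _ (Finite.injective_iff_bijective.1 inj),
    fun x => (cascadeHom g (x, 0)).2, key⟩

/-- The subgroup of `Equiv.Perm (Fin 3 × ZMod 2)` of all permutations of
the form `(x, y) ↦ (σ x, y + f x)` with `σ ∈ Equiv.Perm (Fin 3)` and `f : Fin 3 → ZMod 2`
(the full cascade product of `S₃` in its natural action with a mod-2 counter) is
isomorphic to `Multiplicative (ZMod 2) × Equiv.Perm (Fin 4)`; in particular it has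
order 48. -/
theorem full_cascade_S3_mod2_counter
    (H : Subgroup (Equiv.Perm (Fin 3 × ZMod 2)))
    (hH : ∀ π : Equiv.Perm (Fin 3 × ZMod 2),
      π ∈ H ↔ ∃ (σ : Equiv.Perm (Fin 3)) (f : Fin 3 → ZMod 2),
        ∀ (x : Fin 3) (y : ZMod 2), π (x, y) = (σ x, y + f x)) :
    Nonempty (H ≃* Multiplicative (ZMod 2) × Equiv.Perm (Fin 4)) ∧ Nat.card H = 48 := by
  have hle : Nat.card H ≤ 48 := by
    have hc : ∀ π : H, ∃ q : Equiv.Perm (Fin 3) × (Fin 3 → ZMod 2),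
        ∀ (x : Fin 3) (y : ZMod 2), π.1 (x, y) = (q.1 x, y + q.2 x) := fun π => by
      obtain ⟨σ, f, h⟩ := (hH π.1).1 π.2
      exact ⟨(σ, f), h⟩
    choose q hq using hc
    have hinj : Function.Injective q := by
      intro π π' h
      apply Subtype.ext
      ext1 ⟨x, y⟩
      rw [hq, hq, h]
    refine (Nat.card_le_card_of_injective q hinj).trans ?_
    simp [Nat.card_eq_fintype_card, Fintype.card_perm, ZMod.card, Nat.factorial]
  have hcard : Nat.card (Multiplicative (ZMod 2) × Equiv.Perm (Fin 4)) = 48 := by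
    rw [Nat.card_prod, Nat.card_perm, Nat.card_congr Multiplicative.toAdd, Nat.card_zmod]
    simp [Nat.factorial]
  let φ : Multiplicative (ZMod 2) × Equiv.Perm (Fin 4) →* H :=
    cascadeHom.codRestrict H (fun g => (hH _).2 (cascadeHom_form g))
  have hφ : Function.Injective φ := fun a b h =>
    cascadeHom_injective (congrArg Subtype.val h)
  have hbij : Function.Bijective φ :=
    hφ.bijective_of_nat_card_le (hle.trans hcard.ge)
  let e := MulEquiv.ofBijective φ hbij
  exact ⟨⟨e.symm⟩, (Nat.card_congr e.toEquiv).symm.trans hcard⟩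
end

section
/- Let i and j be the permutations of ZMod 2 × ZMod 2 × ZMod 2 given by i(x₁, x₂, x₃) = (x₁, x₂ + 1, x₃ + (1 + x₁ + x₂)) and j(x₁, x₂, x₃) = (x₁ + 1, x₂, x₃ + (1 + x₁)). Then the subgroup of Equiv.Perm (ZMod 2 × ZMod 2 × ZMod 2) generated by {i, j} is isomorphic as a group to QuaternionGroup 2, the quaternion group Q₈ of order 8. Hence the quaternion group, which is not a semidirect product, can be realized exactly as a cascade product of three mod-2 counters. -/
/-- The concrete permutation `i`. -/
def cascI : Equiv.Perm (ZMod 2 × ZMod 2 × ZMod 2) where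
  toFun x := (x.1, x.2.1 + 1, x.2.2 + (1 + x.1 + x.2.1))
  invFun x := (x.1, x.2.1 + 1, x.2.2 + (x.1 + x.2.1))
  left_inv := by unfold Function.LeftInverse; decide +kernel
  right_inv := by unfold Function.RightInverse Function.LeftInverse; decide +kernel

/-- The concrete permutation `j`. -/
def cascJ : Equiv.Perm (ZMod 2 × ZMod 2 × ZMod 2) where
  toFun x := (x.1 + 1, x.2.1, x.2.2 + (1 + x.1))
  invFun x := (x.1 + 1, x.2.1, x.2.2 + x.1)
  left_inv := by unfold Function.LeftInverse; decide +kernel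
  right_inv := by unfold Function.RightInverse Function.LeftInverse; decide +kernel

/-- The underlying map of the embedding of `Q₈`. -/
def cascFun : QuaternionGroup 2 → Equiv.Perm (ZMod 2 × ZMod 2 × ZMod 2)
  | .a k => cascI ^ (ZMod.val k)
  | .xa k => cascJ * cascI ^ (ZMod.val k)

theorem cascFun_mul_aux : ∀ k l : ZMod 4,
    (cascFun (.a k * .a l) = cascFun (.a k) * cascFun (.a l)) ∧
    (cascFun (.a k * .xa l) = cascFun (.a k) * cascFun (.xa l)) ∧
    (cascFun (.xa k * .a l) = cascFun (.xa k) * cascFun (.a l)) ∧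
    (cascFun (.xa k * .xa l) = cascFun (.xa k) * cascFun (.xa l)) := by
  decide +kernel

theorem cascFun_inj_aux : ∀ k : ZMod 4,
    (cascFun (.a k) = 1 → k = 0) ∧ cascFun (.xa k) ≠ 1 := by
  decide +kernel

/-- The embedding of `Q₈`. -/
def cascHom : QuaternionGroup 2 →* Equiv.Perm (ZMod 2 × ZMod 2 × ZMod 2) :=
  MonoidHom.mk' cascFun (by
    rintro (k | k) (l | l)
    · exact (cascFun_mul_aux k l).1
    · exact (cascFun_mul_aux k l).2.1
    · exact (cascFun_mul_aux k l).2.2.1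
    · exact (cascFun_mul_aux k l).2.2.2)

theorem cascHom_injective : Function.Injective cascHom := by
  rw [injective_iff_map_eq_one]
  rintro (k | k) h
  · have hk := (cascFun_inj_aux k).1 h
    subst hk
    rfl
  · exact absurd h (cascFun_inj_aux k).2

theorem cascHom_range : cascHom.range = Subgroup.closure {cascI, cascJ} := by
  apply le_antisymm
  · have hI : cascI ∈ Subgroup.closure {cascI, cascJ} := Subgroup.subset_closure (by simp)
    have hJ : cascJ ∈ Subgroup.closure {cascI, cascJ} := Subgroup.subset_closure (by simp)
    rintro _ ⟨k | k, rfl⟩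
    · exact Subgroup.pow_mem _ hI _
    · exact Subgroup.mul_mem _ hJ (Subgroup.pow_mem _ hI _)
  · rw [Subgroup.closure_le]
    rintro x (rfl | rfl)
    · exact ⟨.a 1, pow_one _⟩
    · exact ⟨.xa 0, mul_one _⟩

/-- Let `i` and `j` be the permutations of `ZMod 2 × ZMod 2 × ZMod 2` given
by `i(x₁, x₂, x₃) = (x₁, x₂ + 1, x₃ + (1 + x₁ + x₂))` and
`j(x₁, x₂, x₃) = (x₁ + 1, x₂, x₃ + (1 + x₁))`. Then the subgroup they generate is
isomorphic to the quaternion group `Q₈` of order 8: the quaternion group is realized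
exactly as a cascade product of three mod-2 counters. -/
theorem quaternion_as_cascade_of_three_mod2_counters
    (i j : Equiv.Perm (ZMod 2 × ZMod 2 × ZMod 2))
    (hi : ∀ x₁ x₂ x₃ : ZMod 2, i (x₁, x₂, x₃) = (x₁, x₂ + 1, x₃ + (1 + x₁ + x₂)))
    (hj : ∀ x₁ x₂ x₃ : ZMod 2, j (x₁, x₂, x₃) = (x₁ + 1, x₂, x₃ + (1 + x₁))) :
    Nonempty ((Subgroup.closure {i, j} : Subgroup (Equiv.Perm (ZMod 2 × ZMod 2 × ZMod 2)))
      ≃* QuaternionGroup 2) := by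
  have h1 : i = cascI := Equiv.ext fun x => hi x.1 x.2.1 x.2.2
  have h2 : j = cascJ := Equiv.ext fun x => hj x.1 x.2.1 x.2.2
  subst h1 h2
  rw [← cascHom_range]
  exact ⟨(MonoidHom.ofInjective cascHom_injective).symm⟩
end

section
/- Let ℓ and t be the permutations of ℤ × Finset ℤ given by ℓ(k, S) = (k, symmDiff S {k}) (toggling the lamp at position k) and t(k, S) = (k + 1, S) (moving the lamplighter one step). Let σ : Multiplicative ℤ →* MulAut (Multiplicative (ℤ →₀ ZMod 2)) be the shift action, where the integer n acts on a finitely supported function f : ℤ →₀ ZMod 2 by translating its domain by n (Finsupp.mapDomain (· + n)). Then the subgroup of Equiv.Perm (ℤ × Finset ℤ) generated by {ℓ, t} is isomorphic as a group to the semidirect product Multiplicative (ℤ →₀ ZMod 2) ⋊[σ] Multiplicative ℤ, i.e. to the lamplighter group ℤ₂ ≀ ℤ. Hence the lamplighter group is a two-level cascade product with top component ℤ acting on itself by translation and bottom component the restricted direct sum of copies of ℤ/2ℤ acting on finite subsets of ℤ. -/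
/-- The state reached from `p` by moving `n` steps and then toggling the lamps of `f`, read off
relative to the current position. -/
def lampAct (f : ℤ →₀ ZMod 2) (n : ℤ) (p : ℤ × Finset ℤ) : ℤ × Finset ℤ :=
  (p.1 + n, symmDiff p.2 (f.support.image (fun i => p.1 + n - i)))

lemma mem_lamp_image (f : ℤ →₀ ZMod 2) (k x : ℤ) :
    x ∈ f.support.image (fun i => k - i) ↔ f (k - x) ≠ 0 := by
  simp only [Finset.mem_image, Finsupp.mem_support_iff]
  constructor
  · rintro ⟨i, hi, rfl⟩
    simpa using hi
  · intro h
    exact ⟨k - x, h, by ring⟩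

lemma zmod_two_add_ne (a b : ZMod 2) : a + b ≠ 0 ↔ (¬ (a ≠ 0 ↔ b ≠ 0)) := by
  revert a b; decide

lemma lampAct_comp (f g : ℤ →₀ ZMod 2) (m n : ℤ) (p : ℤ × Finset ℤ) :
    lampAct (f + Finsupp.mapDomain (· + m) g) (m + n) p = lampAct f m (lampAct g n p) := by
  obtain ⟨k, S⟩ := p
  refine Prod.ext ?_ ?_
  · simp only [lampAct]; ring
  · ext x
    have h : Finsupp.mapDomain (· + m) g (k + (m + n) - x) = g (k + n - x) := by
      have := Finsupp.mapDomain_apply (add_left_injective m) g (k + n - x)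
      rw [← this]; congr 1; ring
    have h2 : k + n + m = k + (m + n) := by ring
    simp only [lampAct, Finset.mem_symmDiff, mem_lamp_image, Finsupp.add_apply, h, h2,
      zmod_two_add_ne]
    tauto

lemma lampAct_zero (p : ℤ × Finset ℤ) : lampAct 0 0 p = p := by
  have h : symmDiff p.2 ∅ = p.2 := symmDiff_bot p.2
  simp [lampAct, h]

/-- Let `ℓ` and `t` be the permutations of `ℤ × Finset ℤ` with
`ℓ(k, S) = (k, S ∆ {k})` (toggle the lamp at the lamplighter's position) and
`t(k, S) = (k + 1, S)` (move the lamplighter), and let `σ` be the shift action of `ℤ`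
on the group of finitely supported functions `ℤ →₀ ZMod 2`. Then the subgroup of
`Equiv.Perm (ℤ × Finset ℤ)` generated by `{ℓ, t}` is isomorphic to the lamplighter group
`ℤ₂ ≀ ℤ = Multiplicative (ℤ →₀ ZMod 2) ⋊[σ] Multiplicative ℤ`: the lamplighter group is
a two-level cascade product. -/
theorem lamplighter_as_cascade
    (ℓ t : Equiv.Perm (ℤ × Finset ℤ))
    (hℓ : ∀ (k : ℤ) (S : Finset ℤ), ℓ (k, S) = (k, symmDiff S {k}))
    (ht : ∀ (k : ℤ) (S : Finset ℤ), t (k, S) = (k + 1, S))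
    (σ : Multiplicative ℤ →* MulAut (Multiplicative (ℤ →₀ ZMod 2)))
    (hσ : ∀ (n : ℤ) (f : ℤ →₀ ZMod 2),
      σ (Multiplicative.ofAdd n) (Multiplicative.ofAdd f) =
        Multiplicative.ofAdd (Finsupp.mapDomain (· + n) f)) :
    Nonempty ((Subgroup.closure {ℓ, t} : Subgroup (Equiv.Perm (ℤ × Finset ℤ)))
      ≃* (Multiplicative (ℤ →₀ ZMod 2) ⋊[σ] Multiplicative ℤ)) := by
  have hmul : ∀ a b : Multiplicative (ℤ →₀ ZMod 2) ⋊[σ] Multiplicative ℤ, ∀ p,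
      lampAct (a * b).left.toAdd (a * b).right.toAdd p =
        lampAct a.left.toAdd a.right.toAdd (lampAct b.left.toAdd b.right.toAdd p) := by
    intro a b p
    rw [← lampAct_comp]
    have := hσ a.right.toAdd b.left.toAdd
    simp only [ofAdd_toAdd] at this
    rw [SemidirectProduct.mul_left, SemidirectProduct.mul_right, this]
    rfl
  let act : MulAction (Multiplicative (ℤ →₀ ZMod 2) ⋊[σ] Multiplicative ℤ) (ℤ × Finset ℤ) :=
    { smul := fun a p => lampAct a.left.toAdd a.right.toAdd p
      one_smul := fun p => lampAct_zero p
      mul_smul := hmul }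
  let Φ := MulAction.toPermHom (Multiplicative (ℤ →₀ ZMod 2) ⋊[σ] Multiplicative ℤ) (ℤ × Finset ℤ)
  have hΦ : ∀ a p, Φ a p = lampAct a.left.toAdd a.right.toAdd p := fun a p => rfl
  have hinj : Function.Injective Φ := by
    rw [injective_iff_map_eq_one]
    intro a ha
    have h0 : lampAct a.left.toAdd a.right.toAdd (0, ∅) = (0, ∅) := by
      rw [← hΦ, ha]; rfl
    have h1 : a.right.toAdd = 0 := by
      have := congrArg Prod.fst h0
      simpa [lampAct] using this
    have h2 : a.left.toAdd = 0 := by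
      have := congrArg Prod.snd h0
      simpa [lampAct] using this
    exact SemidirectProduct.ext h2 h1
  let L : Multiplicative (ℤ →₀ ZMod 2) ⋊[σ] Multiplicative ℤ :=
    SemidirectProduct.inl (Multiplicative.ofAdd (Finsupp.single 0 1))
  let T : Multiplicative (ℤ →₀ ZMod 2) ⋊[σ] Multiplicative ℤ :=
    SemidirectProduct.inr (Multiplicative.ofAdd 1)
  have hL : Φ L = ℓ := by
    ext1 ⟨k, S⟩
    rw [hΦ, hℓ]
    simp [L, lampAct]
  have hT : Φ T = t := by
    ext1 ⟨k, S⟩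
    rw [hΦ, ht]
    simp [T, lampAct]
  have hgen : Subgroup.closure {L, T} = ⊤ := by
    have hLm : L ∈ Subgroup.closure {L, T} := Subgroup.subset_closure (by simp)
    have hTm : T ∈ Subgroup.closure {L, T} := Subgroup.subset_closure (by simp)
    have hr : ∀ n : Multiplicative ℤ, SemidirectProduct.inr n ∈ Subgroup.closure {L, T} := by
      intro n
      have : (SemidirectProduct.inr n : Multiplicative (ℤ →₀ ZMod 2) ⋊[σ] Multiplicative ℤ)
          = T ^ (n.toAdd) := by
        rw [← map_zpow]; congr 1
        rw [← ofAdd_zsmul]; simp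
      rw [this]
      exact Subgroup.zpow_mem _ hTm _
    have hl : ∀ f : ℤ →₀ ZMod 2,
        SemidirectProduct.inl (Multiplicative.ofAdd f) ∈ Subgroup.closure {L, T} := by
      intro f
      induction f using Finsupp.induction_linear with
      | zero => rw [ofAdd_zero, map_one]; exact Subgroup.one_mem _
      | add f g hf hg => rw [ofAdd_add, map_mul]; exact Subgroup.mul_mem _ hf hg
      | single i b =>
        have hb : b = 0 ∨ b = 1 := by revert b; decide
        rcases hb with rfl | rfl
        · rw [Finsupp.single_zero, ofAdd_zero, map_one]; exact Subgroup.one_mem _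
        · have := SemidirectProduct.inl_aut (φ := σ) (Multiplicative.ofAdd i)
            (Multiplicative.ofAdd (Finsupp.single 0 1))
          rw [hσ, Finsupp.mapDomain_single, zero_add] at this
          rw [this]
          exact Subgroup.mul_mem _ (Subgroup.mul_mem _ (hr _) hLm) (hr _)
    rw [eq_top_iff]
    intro a _
    rw [← SemidirectProduct.inl_left_mul_inr_right a]
    exact Subgroup.mul_mem _ (hl a.left.toAdd) (hr _)
  have hrange : Φ.range = Subgroup.closure {ℓ, t} := by
    rw [MonoidHom.range_eq_map, ← hgen, MonoidHom.map_closure, Set.image_pair, hL, hT]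
  rw [← hrange]
  exact ⟨(MonoidHom.ofInjective hinj).symm⟩
end
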